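/- arXiv:0809.0400 — 9 statements merged into one kernel-verified Lean document; each statement's English description precedes it below -/
import Mathlib

section
/- Let ⟨1, c₂, …, c_m⟩ be a non-canonical coin system and let x be its smallest counterexample. Write GRD(x) = (β₁, …, β_m). Then for every optimal representation (α₁, …, α_m) of x one has αᵢ·βᵢ = 0 for every i with 1 ≤ i ≤ m; that is, the greedy representation and any optimal representation of the smallest counterexample use disjoint sets of coin types. -/
/-- A coin system `⟨c 1, c 2, …, c m⟩` is a strictly increasing finite sequence of
positive integers with `c 1 = 1` (only the values `c i` for `1 ≤ i ≤ m` matter). -/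
def IsCoinSystem (m : ℕ) (c : ℕ → ℕ) : Prop :=
  c 1 = 1 ∧ ∀ i j, 1 ≤ i → i < j → j ≤ m → c i < c j

/-- `α` is a representation of `x` under the coin system `⟨c 1, …, c m⟩`. -/
def IsRepr (m : ℕ) (c : ℕ → ℕ) (x : ℕ) (α : ℕ → ℕ) : Prop :=
  ∑ i ∈ Finset.Icc 1 m, α i * c i = x

/-- The size of a representation, i.e. the total number of coins used. -/
def reprSize (m : ℕ) (α : ℕ → ℕ) : ℕ :=
  ∑ i ∈ Finset.Icc 1 m, α i

/-- `α` is the greedy representation of `x`: a representation such that for every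
`2 ≤ i ≤ m` the part of the sum using coins smaller than `c i` is `< c i`. -/
def IsGreedy (m : ℕ) (c : ℕ → ℕ) (x : ℕ) (α : ℕ → ℕ) : Prop :=
  IsRepr m c x α ∧
    ∀ i, 2 ≤ i → i ≤ m → ∑ j ∈ Finset.Icc 1 (i - 1), α j * c j < c i

/-- `α` is an optimal (minimum-size) representation of `x`. -/
def IsOpt (m : ℕ) (c : ℕ → ℕ) (x : ℕ) (α : ℕ → ℕ) : Prop :=
  IsRepr m c x α ∧ ∀ β, IsRepr m c x β → reprSize m α ≤ reprSize m β

/-- `x` is a counterexample: the greedy representation of `x` is strictly larger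
than some representation of `x` (equivalently, than an optimal one). -/
def IsCounterexample (m : ℕ) (c : ℕ → ℕ) (x : ℕ) : Prop :=
  ∃ γ β, IsGreedy m c x γ ∧ IsRepr m c x β ∧ reprSize m β < reprSize m γ

/-- A coin system is non-canonical if it has a counterexample. -/
def NonCanonical (m : ℕ) (c : ℕ → ℕ) : Prop :=
  ∃ x, IsCounterexample m c x

/-- A coin system is canonical if `|GRD(x)| = |OPT(x)|` for all `x`,
i.e. it has no counterexample. -/
def IsCanonical (m : ℕ) (c : ℕ → ℕ) : Prop :=
  ∀ x, ¬ IsCounterexample m c x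

/-- A coin system is tight if it has no counterexample smaller than its largest coin. -/
def Tight (m : ℕ) (c : ℕ → ℕ) : Prop :=
  ∀ x, x < c m → ¬ IsCounterexample m c x

/-- `x` is the smallest counterexample of the coin system. -/
def SmallestCounterexample (m : ℕ) (c : ℕ → ℕ) (x : ℕ) : Prop :=
  IsCounterexample m c x ∧ ∀ y, y < x → ¬ IsCounterexample m c y

/-- In a coin system every coin is positive. -/
theorem IsCoinSystem.pos {m : ℕ} {c : ℕ → ℕ} (hc : IsCoinSystem m c) {i : ℕ}
    (hi : 1 ≤ i) (him : i ≤ m) : 0 < c i := by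
  rcases hi.eq_or_lt with rfl | h
  · rw [hc.1]
    exact one_pos
  · exact (Nat.zero_le _).trans_lt (hc.2 1 i le_rfl h him)

/-- Two coefficient sequences satisfying the greedy condition and having the same total value
agree. -/
theorem eq_of_sum_eq_of_partial_sums_lt {c a b : ℕ → ℕ} {n : ℕ}
    (ha : ∀ i, 1 ≤ i → i ≤ n → ∑ j ∈ Finset.Icc 1 (i - 1), a j * c j < c i)
    (hb : ∀ i, 1 ≤ i → i ≤ n → ∑ j ∈ Finset.Icc 1 (i - 1), b j * c j < c i)
    (h : ∑ j ∈ Finset.Icc 1 n, a j * c j = ∑ j ∈ Finset.Icc 1 n, b j * c j) :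
    ∀ i ∈ Finset.Icc 1 n, a i = b i := by
  induction n with
  | zero => simp
  | succ n ih =>
    have hsa := ha (n + 1) (by omega) le_rfl
    have hsb := hb (n + 1) (by omega) le_rfl
    rw [Nat.add_sub_cancel] at hsa hsb
    rw [Finset.sum_Icc_succ_top (by omega), Finset.sum_Icc_succ_top (by omega)] at h
    have hpos : 0 < c (n + 1) := (Nat.zero_le _).trans_lt hsa
    have hdiv := congrArg (· / c (n + 1)) h
    simp only [Nat.add_mul_div_right _ _ hpos, Nat.div_eq_of_lt hsa, Nat.div_eq_of_lt hsb,
      zero_add] at hdiv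
    rw [hdiv] at h
    intro i hi
    rw [Finset.mem_Icc] at hi
    rcases hi.2.eq_or_lt with rfl | hlt
    · exact hdiv
    · exact ih (fun j h1 h2 => ha j h1 (by omega)) (fun j h1 h2 => hb j h1 (by omega))
        (Nat.add_right_cancel h) i (Finset.mem_Icc.2 ⟨hi.1, by omega⟩)

/-- The greedy condition also holds trivially at the first coin. -/
theorem IsGreedy.partial_sum_lt {m : ℕ} {c : ℕ → ℕ} {x : ℕ} {a : ℕ → ℕ}
    (hc : IsCoinSystem m c) (ha : IsGreedy m c x a) (i : ℕ) (hi : 1 ≤ i) (him : i ≤ m) :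
    ∑ j ∈ Finset.Icc 1 (i - 1), a j * c j < c i := by
  rcases hi.eq_or_lt with rfl | h
  · simp [hc.1]
  · exact ha.2 i h him

/-- All greedy representations of a number have the same size. -/
theorem IsGreedy.reprSize_eq {m : ℕ} {c : ℕ → ℕ} {x : ℕ} {a b : ℕ → ℕ}
    (hc : IsCoinSystem m c) (ha : IsGreedy m c x a) (hb : IsGreedy m c x b) :
    reprSize m a = reprSize m b :=
  Finset.sum_congr rfl <| eq_of_sum_eq_of_partial_sums_lt
    (ha.partial_sum_lt hc) (hb.partial_sum_lt hc) (ha.1.trans hb.1.symm)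

/-- Remove one coin of type `i`. -/
def removeCoin (i : ℕ) (a : ℕ → ℕ) : ℕ → ℕ :=
  fun j => a j - if j = i then 1 else 0

theorem sum_removeCoin_mul_add {m i : ℕ} {a : ℕ → ℕ} (c : ℕ → ℕ)
    (hi : i ∈ Finset.Icc 1 m) (ha : 0 < a i) :
    ∑ j ∈ Finset.Icc 1 m, removeCoin i a j * c j + c i =
      ∑ j ∈ Finset.Icc 1 m, a j * c j := by
  have hci : ∑ j ∈ Finset.Icc 1 m, (if j = i then c j else 0) = c i := by
    rw [Finset.sum_ite_eq', if_pos hi]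
  rw [← hci, ← Finset.sum_add_distrib]
  refine Finset.sum_congr rfl fun j _ => ?_
  by_cases hj : j = i
  · subst hj
    obtain ⟨k, hk⟩ := Nat.exists_eq_add_of_lt ha
    simp only [removeCoin, hk, if_true]
    rw [Nat.add_sub_cancel]
    ring
  · simp [removeCoin, hj]

theorem reprSize_removeCoin_add_one {m i : ℕ} {a : ℕ → ℕ}
    (hi : i ∈ Finset.Icc 1 m) (ha : 0 < a i) :
    reprSize m (removeCoin i a) + 1 = reprSize m a := by
  simpa [reprSize] using sum_removeCoin_mul_add (fun _ => 1) hi ha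

theorem IsRepr.removeCoin {m i : ℕ} {c : ℕ → ℕ} {x : ℕ} {a : ℕ → ℕ}
    (h : IsRepr m c x a) (hi : i ∈ Finset.Icc 1 m) (ha : 0 < a i) :
    IsRepr m c (x - c i) (removeCoin i a) := by
  have hsum := (sum_removeCoin_mul_add c hi ha).trans h
  exact Nat.eq_sub_of_add_eq hsum

theorem IsGreedy.removeCoin {m i : ℕ} {c : ℕ → ℕ} {x : ℕ} {a : ℕ → ℕ}
    (h : IsGreedy m c x a) (hi : i ∈ Finset.Icc 1 m) (ha : 0 < a i) :
    IsGreedy m c (x - c i) (removeCoin i a) :=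
  ⟨h.1.removeCoin hi ha, fun k hk hkm =>
    (Finset.sum_le_sum fun _ _ => Nat.mul_le_mul_right _ (Nat.sub_le _ _)).trans_lt
      (h.2 k hk hkm)⟩

/-- Tien–Hu: the greedy representation and any optimal representation of the
smallest counterexample use disjoint sets of coin types. -/
theorem stmt_0 (m : ℕ) (c : ℕ → ℕ) (hm : 2 ≤ m) (hc : IsCoinSystem m c)
    (x : ℕ) (hx : SmallestCounterexample m c x)
    (β : ℕ → ℕ) (hβ : IsGreedy m c x β)
    (α : ℕ → ℕ) (hα : IsOpt m c x α) :
    ∀ i, 1 ≤ i → i ≤ m → α i * β i = 0 := by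
  intro i hi him
  by_contra hne
  obtain ⟨hαi, hβi⟩ := mul_ne_zero_iff.1 hne
  replace hαi := Nat.pos_of_ne_zero hαi
  replace hβi := Nat.pos_of_ne_zero hβi
  have hmem : i ∈ Finset.Icc 1 m := Finset.mem_Icc.2 ⟨hi, him⟩
  obtain ⟨⟨γ, δ, hγ, hδ, hlt⟩, hmin⟩ := hx
  have hsize : reprSize m α < reprSize m β := by
    rw [hβ.reprSize_eq hc hγ]
    exact (hα.2 δ hδ).trans_lt hlt
  have hxi : x - c i < x := by
    have hsum := (sum_removeCoin_mul_add c hmem hβi).trans hβ.1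
    have hpos := hc.pos hi him
    omega
  refine hmin _ hxi ⟨removeCoin i β, removeCoin i α, hβ.removeCoin hmem hβi,
    hα.1.removeCoin hmem hαi, ?_⟩
  have h1 := reprSize_removeCoin_add_one hmem hαi
  have h2 := reprSize_removeCoin_add_one hmem hβi
  omega
end

section
/- Let ⟨1, c₂, …, c_m⟩ and ⟨1, c₂, …, c_m, c_{m+1}⟩ be coin systems (so c_m < c_{m+1}) such that ⟨1, c₂, …, c_m⟩ is canonical but ⟨1, c₂, …, c_m, c_{m+1}⟩ is not. Then there exists a natural number k such that k·c_m < c_{m+1} < (k+1)·c_m and (k+1)·c_m is a counterexample of ⟨1, c₂, …, c_m, c_{m+1}⟩. -/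
theorem sum_Icc_one_succ (n : ℕ) (f : ℕ → ℕ) :
    ∑ i ∈ Finset.Icc 1 (n + 1), f i = ∑ i ∈ Finset.Icc 1 n, f i + f (n + 1) :=
  Finset.sum_Icc_succ_top (by omega) f

/-- Appending `t` copies of a new largest coin to a greedy representation. -/
theorem IsGreedy.append {m : ℕ} {c : ℕ → ℕ} {r : ℕ} {α : ℕ → ℕ} (h : IsGreedy m c r α)
    (hr : r < c (m + 1)) (t : ℕ) :
    ∃ β, IsGreedy (m + 1) c (r + t * c (m + 1)) β ∧
      reprSize (m + 1) β = reprSize m α + t := by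
  have key : ∀ n ≤ m, ∀ f : ℕ → ℕ, ∑ i ∈ Finset.Icc 1 n, (if i ≤ m then α i else t) * f i =
      ∑ i ∈ Finset.Icc 1 n, α i * f i := fun n hn f =>
    Finset.sum_congr rfl fun i hi => by
      rw [if_pos ((Finset.mem_Icc.mp hi).2.trans hn)]
  have hrepr := h.1
  unfold IsRepr at hrepr
  refine ⟨fun i => if i ≤ m then α i else t, ⟨?_, fun i hi him => ?_⟩, ?_⟩
  · unfold IsRepr
    rw [sum_Icc_one_succ, key m le_rfl c, hrepr]
    simp
  · rw [key (i - 1) (by omega) c]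
    rcases Nat.lt_or_ge m i with hlt | hle
    · obtain rfl : i = m + 1 := by omega
      simpa [hrepr] using hr
    · exact h.2 i hi hle
  · have := key m le_rfl fun _ => 1
    simp only [mul_one] at this
    unfold reprSize
    rw [sum_Icc_one_succ, this]
    simp

/-- Every natural number has a greedy representation. -/
theorem IsCoinSystem.exists_isGreedy {c : ℕ → ℕ} {m : ℕ} (hm : 1 ≤ m)
    (hc : IsCoinSystem m c) (x : ℕ) : ∃ α, IsGreedy m c x α := by
  induction m, hm using Nat.le_induction generalizing x with
  | base => exact ⟨fun _ => x, by simp [IsRepr, hc.1], fun i _ _ => by omega⟩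
  | succ m hm ih =>
    have hpos : 0 < c (m + 1) := (Nat.zero_le _).trans_lt (hc.2 1 (m + 1) le_rfl (by omega) le_rfl)
    obtain ⟨α, hα⟩ := ih ⟨hc.1, fun i j hi hij hj => hc.2 i j hi hij (by omega)⟩ (x % c (m + 1))
    obtain ⟨β, hβ, -⟩ := hα.append (Nat.mod_lt _ hpos) (x / c (m + 1))
    rw [Nat.mod_add_div'] at hβ
    exact ⟨β, hβ⟩

/-- Adding `q` copies of the largest coin to a greedy representation keeps it greedy. -/
theorem IsGreedy.add_largest {m : ℕ} {c : ℕ → ℕ} {x : ℕ} {α : ℕ → ℕ} (hm : 1 ≤ m)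
    (h : IsGreedy m c x α) (q : ℕ) :
    ∃ β, IsGreedy m c (x + q * c m) β ∧ reprSize m β = reprSize m α + q := by
  have hrepr := h.1
  unfold IsRepr at hrepr
  refine ⟨fun i => α i + if i = m then q else 0, ⟨?_, fun i hi him => ?_⟩, ?_⟩
  · simp [IsRepr, add_mul, Finset.sum_add_distrib, hrepr, hm]
  · refine lt_of_eq_of_lt (Finset.sum_congr rfl fun j hj => ?_) (h.2 i hi him)
    have := Finset.mem_Icc.mp hj
    simp only [if_neg (show j ≠ m by omega), add_zero]
  · simp [reprSize, Finset.sum_add_distrib, hm]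

theorem IsRepr.add {m : ℕ} {c : ℕ → ℕ} {x y : ℕ} {α β : ℕ → ℕ} (hα : IsRepr m c x α)
    (hβ : IsRepr m c y β) : IsRepr m c (x + y) (α + β) := by
  unfold IsRepr at *
  simp [add_mul, Finset.sum_add_distrib, hα, hβ]

theorem reprSize_add (m : ℕ) (α β : ℕ → ℕ) :
    reprSize m (α + β) = reprSize m α + reprSize m β := by
  simp [reprSize, Finset.sum_add_distrib]

theorem IsCanonical.reprSize_le {m : ℕ} {c : ℕ → ℕ} (hcan : IsCanonical m c) {x : ℕ}
    {γ β : ℕ → ℕ} (hγ : IsGreedy m c x γ) (hβ : IsRepr m c x β) :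
    reprSize m γ ≤ reprSize m β :=
  not_lt.mp fun h => hcan x ⟨γ, β, hγ, hβ, h⟩

/-- In a canonical system, if `d = q * c m - δ` and `δ` needs fewer than `q` coins, then adding
`s * d` to an amount increases its greedy size by at least `s`. -/
theorem IsCanonical.reprSize_add_le {m : ℕ} {c : ℕ → ℕ} (hm : 1 ≤ m) (hc : IsCoinSystem m c)
    (hcan : IsCanonical m c) {d δ q : ℕ} (hq : d + δ = q * c m) {ε : ℕ → ℕ}
    (hε : IsRepr m c δ ε) (hlt : reprSize m ε < q) {y : ℕ} {γ : ℕ → ℕ} (hγ : IsGreedy m c y γ)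
    (s : ℕ) {β : ℕ → ℕ} (hβ : IsRepr m c (y + s * d) β) :
    reprSize m γ + s ≤ reprSize m β := by
  induction s generalizing β with
  | zero => exact hcan.reprSize_le hγ (by simpa using hβ)
  | succ s ih =>
    obtain ⟨η, hη⟩ := hc.exists_isGreedy hm (y + s * d)
    obtain ⟨θ, hθ, hsize⟩ := hη.add_largest hm q
    have hsum := hβ.add hε
    rw [show y + (s + 1) * d + δ = y + s * d + q * c m by rw [← hq]; ring] at hsum
    have hle := hcan.reprSize_le hθ hsum
    rw [reprSize_add] at hle
    have := ih hη.1
    omega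

/-- Tien–Hu: if `⟨1, c 2, …, c m⟩` is canonical but `⟨1, c 2, …, c m, c (m+1)⟩` is not,
then some `(k+1) * c m` with `k * c m < c (m+1) < (k+1) * c m` is a counterexample. -/
theorem stmt_1 (m : ℕ) (c : ℕ → ℕ) (hm : 2 ≤ m)
    (hc : IsCoinSystem (m + 1) c)
    (hcan : IsCanonical m c) (hnon : NonCanonical (m + 1) c) :
    ∃ k : ℕ, k * c m < c (m + 1) ∧ c (m + 1) < (k + 1) * c m ∧
      IsCounterexample (m + 1) c ((k + 1) * c m) := by
  have hc' : IsCoinSystem m c := ⟨hc.1, fun i j hi hij hj => hc.2 i j hi hij (by omega)⟩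
  have hm1 : 1 ≤ m := by omega
  have ha : 0 < c m := (Nat.zero_le _).trans_lt (hc.2 1 m le_rfl (by omega) (by omega))
  have had : c m < c (m + 1) := hc.2 m (m + 1) hm1 (by omega) le_rfl
  obtain ⟨k, hk, hk'⟩ : ∃ k, k * c m < c (m + 1) ∧ c (m + 1) ≤ (k + 1) * c m := by
    refine ⟨(c (m + 1) - 1) / c m, ?_, ?_⟩
    · have := Nat.div_mul_le_self (c (m + 1) - 1) (c m)
      omega
    · have := Nat.lt_mul_of_div_lt (Nat.lt_add_one ((c (m + 1) - 1) / c m)) ha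
      omega
  obtain ⟨δ, hδ⟩ := Nat.exists_eq_add_of_le hk'
  have hδa : δ < c m := by
    rw [add_mul, one_mul] at hδ
    omega
  obtain ⟨ε, hε⟩ := hc'.exists_isGreedy hm1 δ
  rcases Nat.lt_or_ge (reprSize m ε) (k + 1) with hlt | hge
  · exfalso
    obtain ⟨x, γ, β, hγ, hβ, hβγ⟩ := hnon
    have hr : ∑ i ∈ Finset.Icc 1 m, γ i * c i < c (m + 1) := hγ.2 (m + 1) (by omega) le_rfl
    have hx := hγ.1
    unfold IsRepr at hx hβ
    unfold reprSize at hβγ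
    rw [sum_Icc_one_succ] at hx hβ
    rw [sum_Icc_one_succ, sum_Icc_one_succ] at hβγ
    have hst : β (m + 1) ≤ γ (m + 1) := by
      by_contra! h
      have := Nat.mul_le_mul_right (c (m + 1)) (Nat.succ_le_of_lt h)
      rw [Nat.succ_mul] at this
      omega
    obtain ⟨s, hs⟩ := Nat.exists_eq_add_of_le hst
    rw [hs, add_mul] at hx
    have hle := hcan.reprSize_add_le hm1 hc' hδ.symm hε.1 hlt
      (γ := γ) ⟨rfl, fun i hi him => hγ.2 i hi (by omega)⟩ s (β := β)
      (by unfold IsRepr; omega)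
    unfold reprSize at hle
    omega
  · refine ⟨k, hk, lt_of_le_of_ne hk' fun heq => ?_, ?_⟩
    · have hδ0 : δ = 0 := by omega
      have := hcan.reprSize_le hε (β := fun _ => 0) (by simp [IsRepr, hδ0])
      simp only [reprSize, Finset.sum_const_zero] at this hge
      omega
    · obtain ⟨γ, hγ, hγs⟩ := hε.append (hδa.trans had) 1
      rw [one_mul, add_comm δ, ← hδ] at hγ
      refine ⟨γ, fun i => if i = m then k + 1 else 0, hγ, ?_, ?_⟩
      · simp [IsRepr, hm1]
      · have : reprSize (m + 1) (fun i => if i = m then k + 1 else 0) = k + 1 := by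
          simp [reprSize, hm1]
        omega
end

section
/- Let ⟨1, c₂, c₃⟩ be a coin system with three types of coins, and write c₃ = q·c₂ + r with 0 ≤ r ≤ c₂ − 1. Then ⟨1, c₂, c₃⟩ is non-canonical if and only if 0 < r < c₂ − q. -/
/-- If `r = 0` or `b ≤ q + r`, then trading `d` coins of value `q * b + r` for coins of value
`1` and `b` does not reduce the number of coins, as long as fewer than `b` coins of value `1`
were used before. -/
theorem coins_le_of_exchange {b q r d x y u v : ℤ} (hb : 1 < b) (hq : 1 ≤ q) (hr0 : 0 ≤ r)
    (hrb : r < b) (hd : 0 ≤ d) (hxb : x < b) (hu : 0 ≤ u)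
    (h : d * (q * b + r) + x + y * b = u + v * b) (hcase : r = 0 ∨ b ≤ q + r) :
    d + x + y ≤ u + v := by
  obtain ⟨s, hs⟩ : ∃ s, v = d * q + y + s := ⟨v - d * q - y, by ring⟩
  subst hs
  obtain rfl : u = d * r + x - s * b := by linear_combination -h
  suffices s * (b - 1) ≤ d * (q + r - 1) by linarith
  have hright : 0 ≤ d * (q + r - 1) := mul_nonneg hd (by linarith)
  rcases le_or_gt s 0 with hs0 | hs0
  · nlinarith
  rcases hcase with rfl | hbqr
  · nlinarith
  · have hsd : s ≤ d := by
      by_contra! hds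
      nlinarith [mul_le_mul_of_nonneg_left (show r ≤ b - 1 by linarith) hd,
        mul_le_mul_of_nonneg_right (show d + 1 ≤ s by linarith) (show 0 ≤ b by linarith)]
    exact mul_le_mul hsd (by linarith) (by linarith) hd

/-- Kozen–Zaks: `⟨1, c 2, c 3⟩` is non-canonical iff `0 < r < c 2 - q`
where `c 3 = q * c 2 + r` with `0 ≤ r ≤ c 2 - 1`. -/
theorem stmt_3 (c : ℕ → ℕ) (hc : IsCoinSystem 3 c)
    (q r : ℕ) (hr : r ≤ c 2 - 1) (hqr : c 3 = q * c 2 + r) :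
    NonCanonical 3 c ↔ (0 < r ∧ r < c 2 - q) := by
  obtain ⟨h1, hlt⟩ := hc
  have h12 : 1 < c 2 := h1 ▸ hlt 1 2 (by norm_num) (by norm_num) (by norm_num)
  have h23 : c 2 < c 3 := hlt 2 3 (by norm_num) (by norm_num) (by norm_num)
  constructor
  · rintro ⟨x, γ, β, ⟨hγ, hgreedy⟩, hβ, hsize⟩
    by_contra hcon
    have hγ2 := hgreedy 2 (by norm_num) (by norm_num)
    have hγ3 := hgreedy 3 (by norm_num) (by norm_num)
    simp [IsRepr, reprSize, Finset.sum_Icc_succ_top, h1] at hγ hβ hsize hγ2 hγ3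
    have hq : 1 ≤ q := by
      by_contra! hq0
      obtain rfl : q = 0 := by omega
      omega
    have hle : β 3 ≤ γ 3 := by
      by_contra! hgt
      have := Nat.mul_le_mul_right (c 3) (show γ 3 + 1 ≤ β 3 from hgt)
      rw [add_mul] at this
      omega
    have hsum : γ 1 + γ 2 * c 2 + γ 3 * c 3 = β 1 + β 2 * c 2 + β 3 * c 3 := hγ.trans hβ.symm
    rw [hqr] at hsum
    zify at hsum
    have := coins_le_of_exchange (b := c 2) (q := q) (r := r) (d := (γ 3 : ℤ) - β 3)
      (x := γ 1) (y := γ 2) (u := β 1) (v := β 2) (by omega) (by omega) (by omega) (by omega)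
      (by omega) (by omega) (by omega) (by linear_combination hsum) (by omega)
    omega
  · rintro ⟨hr0, hrq⟩
    refine ⟨(q + 1) * c 2, fun i => if i = 1 then c 2 - r else if i = 3 then 1 else 0,
      fun i => if i = 2 then q + 1 else 0, ⟨?_, ?_⟩, ?_, ?_⟩
    · simp [IsRepr, Finset.sum_Icc_succ_top, h1]
      rw [hqr, add_mul]
      omega
    · intro i hi hi3
      interval_cases i <;> simp [Finset.sum_Icc_succ_top, h1] <;> omega
    · simp [IsRepr]
    · simp [reprSize, Finset.sum_Icc_succ_top]
      omega
end

section
/- Let ⟨1, c₂, c₃⟩ be a coin system with three types of coins, let c₃ = q·c₂ + r with 0 ≤ r ≤ c₂ − 1, and assume 0 < r < c₂ − q. Then the number x = c₂ + c₃ − 1 is a counterexample of ⟨1, c₂, c₃⟩: its greedy representation is (c₂ − 1, 0, 1) of size c₂, while (r − 1, q + 1, 0) is a representation of x of size r + q < c₂, so |OPT(x)| < |GRD(x)|. -/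
/-- If `c 3 = q * c 2 + r` with `0 < r < c 2 - q`, then `x = c 2 + c 3 - 1` is a
counterexample of `⟨1, c 2, c 3⟩`: its greedy representation is `(c 2 - 1, 0, 1)`
of size `c 2`, while `(r - 1, q + 1, 0)` is a representation of size `r + q < c 2`. -/
theorem stmt_4 (c : ℕ → ℕ) (hc : IsCoinSystem 3 c)
    (q r : ℕ) (hr : r ≤ c 2 - 1) (hqr : c 3 = q * c 2 + r)
    (h0 : 0 < r) (h1 : r < c 2 - q) :
    IsGreedy 3 c (c 2 + c 3 - 1)
      (fun i => if i = 1 then c 2 - 1 else if i = 2 then 0 else if i = 3 then 1 else 0) ∧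
    reprSize 3
      (fun i => if i = 1 then c 2 - 1 else if i = 2 then 0 else if i = 3 then 1 else 0)
      = c 2 ∧
    IsRepr 3 c (c 2 + c 3 - 1)
      (fun i => if i = 1 then r - 1 else if i = 2 then q + 1 else 0) ∧
    reprSize 3 (fun i => if i = 1 then r - 1 else if i = 2 then q + 1 else 0) = r + q ∧
    r + q < c 2 ∧
    IsCounterexample 3 c (c 2 + c 3 - 1) := by
  have c1 : c 1 = 1 := hc.1
  have h23 : c 2 < c 3 := hc.2 2 3 (by norm_num) (by norm_num) le_rfl
  have hI2 : Finset.Icc 1 2 = ({1, 2} : Finset ℕ) := by decide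
  have hI3 : Finset.Icc 1 3 = ({1, 2, 3} : Finset ℕ) := by decide
  have hgreedy : IsGreedy 3 c (c 2 + c 3 - 1)
      (fun i => if i = 1 then c 2 - 1 else if i = 2 then 0 else if i = 3 then 1 else 0) := by
    refine ⟨?_, fun i hi hi' => ?_⟩
    · simp [IsRepr, hI3, c1]
      omega
    · interval_cases i
      · simp [c1]
        omega
      · simp [hI2, c1]
        omega
  have hgreedySize : reprSize 3
      (fun i => if i = 1 then c 2 - 1 else if i = 2 then 0 else if i = 3 then 1 else 0)
      = c 2 := by
    simp [reprSize, hI3]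
    omega
  have hrepr : IsRepr 3 c (c 2 + c 3 - 1)
      (fun i => if i = 1 then r - 1 else if i = 2 then q + 1 else 0) := by
    simp [IsRepr, hI3, c1, hqr, add_mul]
    omega
  have hreprSize :
      reprSize 3 (fun i => if i = 1 then r - 1 else if i = 2 then q + 1 else 0) = r + q := by
    simp [reprSize, hI3]
    omega
  have hlt : r + q < c 2 := by omega
  exact ⟨hgreedy, hgreedySize, hrepr, hreprSize, hlt, _, _, hgreedy, hrepr,
    by rwa [hreprSize, hgreedySize]⟩
end

section
/- Let ⟨1, c₂, c₃⟩ be a non-canonical coin system. Then for every c₄ > c₃, the coin system ⟨1, c₂, c₃, c₄⟩ is also non-canonical. -/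
/-- A four-coin system is non-canonical as soon as some explicit greedy representation `g`
is larger than another representation `f` of the same amount. -/
theorem NonCanonical.of_four {c : ℕ → ℕ} (h1 : c 1 = 1) (g₁ g₂ g₃ g₄ f₁ f₂ f₃ f₄ : ℕ)
    (hg₂ : g₁ < c 2) (hg₃ : g₁ + g₂ * c 2 < c 3) (hg₄ : g₁ + g₂ * c 2 + g₃ * c 3 < c 4)
    (hrepr : f₁ + f₂ * c 2 + f₃ * c 3 + f₄ * c 4 = g₁ + g₂ * c 2 + g₃ * c 3 + g₄ * c 4)
    (hsize : f₁ + f₂ + f₃ + f₄ < g₁ + g₂ + g₃ + g₄) : NonCanonical 4 c := by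
  refine ⟨g₁ + g₂ * c 2 + g₃ * c 3 + g₄ * c 4,
    fun i => if i = 1 then g₁ else if i = 2 then g₂ else if i = 3 then g₃ else g₄,
    fun i => if i = 1 then f₁ else if i = 2 then f₂ else if i = 3 then f₃ else f₄,
    ⟨?_, ?_⟩, ?_, ?_⟩
  · simp [IsRepr, Finset.sum_Icc_succ_top, h1]
  · intro i hi hi'
    interval_cases i <;> simpa [Finset.sum_Icc_succ_top, h1]
  · simpa [IsRepr, Finset.sum_Icc_succ_top, h1] using hrepr
  · simpa [reprSize, Finset.sum_Icc_succ_top] using hsize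

/-- If `c 3 = m * c 2 - s` and `⟨1, c 2, c 3⟩` is non-canonical, then `m ≤ s`. -/
theorem NonCanonical.le_of_three {c : ℕ → ℕ} (h1 : c 1 = 1) (h2 : 1 < c 2) {m s : ℕ}
    (hms : c 3 + s = m * c 2) (h : NonCanonical 3 c) : m ≤ s := by
  obtain ⟨x, γ, β, ⟨hγ, hgreedy⟩, hβ, hsize⟩ := h
  have hg₂ := hgreedy 2 le_rfl (by norm_num)
  have hg₃ := hgreedy 3 (by norm_num) le_rfl
  simp only [IsRepr] at hγ hβ
  simp only [reprSize] at hsize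
  simp [Finset.sum_Icc_succ_top, h1] at hγ hβ hg₂ hg₃ hsize
  by_contra! hlt
  have hle : β 3 ≤ γ 3 := by
    by_contra! hcon
    nlinarith [Nat.mul_le_mul_right (c 3) (Nat.succ_le_of_lt hcon)]
  obtain ⟨k, hk⟩ := Nat.exists_eq_add_of_le hle
  rw [hk] at hγ hsize
  zify at *
  have key : (β 1 : ℤ) + k * s = γ 1 + (γ 2 + k * m - β 2) * c 2 := by
    linear_combination hβ - hγ + (k : ℤ) * hms
  have ht : 0 ≤ (γ 2 + k * m - β 2 : ℤ) := by
    by_contra! ht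
    have : (0 : ℤ) ≤ β 1 + k * s := by positivity
    nlinarith
  nlinarith [mul_nonneg ht (by linarith : (0 : ℤ) ≤ c 2 - 1),
    mul_nonneg (by positivity : (0 : ℤ) ≤ k) (by linarith : (0 : ℤ) ≤ m - s - 1)]

/-- If `⟨1, c 2, c 3⟩` is non-canonical, then for every `c 4 > c 3` the coin system
`⟨1, c 2, c 3, c 4⟩` is also non-canonical. -/
theorem stmt_7 (c : ℕ → ℕ) (hc : IsCoinSystem 4 c)
    (h : NonCanonical 3 c) : NonCanonical 4 c := by
  obtain ⟨h1, hlt⟩ := hc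
  have h12 : 1 < c 2 := h1 ▸ hlt 1 2 (by norm_num) (by norm_num) (by norm_num)
  have h23 := hlt 2 3 (by norm_num) (by norm_num) (by norm_num)
  have h34 := hlt 3 4 (by norm_num) (by norm_num) (by norm_num)
  obtain ⟨m, s, hs, hms⟩ : ∃ m s, s < c 2 ∧ c 3 + s = m * c 2 := by
    refine ⟨(c 3 + c 2 - 1) / c 2, c 2 - 1 - (c 3 + c 2 - 1) % c 2, by omega, ?_⟩
    have hdiv := Nat.div_add_mod' (c 3 + c 2 - 1) (c 2)
    have hmod := Nat.mod_lt (c 3 + c 2 - 1) (by omega : 0 < c 2)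
    omega
  have hle := h.le_of_three h1 h12 hms
  by_cases hd : c 3 + s < c 4
  · exact .of_four h1 s 0 1 0 0 m 0 0 hs (by omega) (by omega) (by omega) (by omega)
  obtain ⟨e, he⟩ := Nat.exists_eq_add_of_lt h34
  by_cases hb : c 3 = c 2 + (e + 1)
  · have hm : m = 2 := by
      have : 1 < m := by nlinarith
      have : m < 3 := by nlinarith
      omega
    subst hm
    exact .of_four h1 s 0 0 1 0 1 1 0 hs (by omega) (by omega) (by omega) (by omega)
  · have hdiv := Nat.div_add_mod' (c 3 - (e + 1)) (c 2)
    have hmod := Nat.mod_lt (c 3 - (e + 1)) (by omega : 0 < c 2)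
    refine .of_four h1 ((c 3 - (e + 1)) % c 2) ((c 3 - (e + 1)) / c 2) 0 1 0 0 2 0
      hmod (by omega) (by omega) (by omega) ?_
    generalize (c 3 - (e + 1)) % c 2 = u at *
    generalize (c 3 - (e + 1)) / c 2 = v at *
    by_contra! hcon
    have : v ≤ 1 := by omega
    interval_cases v <;> omega
end

section
/- Let m ≥ 4 and let ⟨1, c₂, c₃, …, c_m⟩ be a coin system. If the subsystem ⟨1, c₂, c₃⟩ is non-canonical, then the full coin system ⟨1, c₂, c₃, …, c_m⟩ is non-canonical and moreover possesses a counterexample x with x < c_m + c₃. -/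
/-- The tuple with one coin `c i`, plus `u` coins `c 1`, `v` coins `c 2` and `w` coins `c 3`. -/
def coinTuple (i u v w : ℕ) : ℕ → ℕ := fun l =>
  (if l = i then 1 else 0) + (if l = 1 then u else 0) + (if l = 2 then v else 0) +
    (if l = 3 then w else 0)

lemma sum_coinTuple_mul (n i u v w : ℕ) (c : ℕ → ℕ) :
    ∑ l ∈ Finset.Icc 1 n, coinTuple i u v w l * c l =
      (if 1 ≤ i ∧ i ≤ n then c i else 0) + (if 1 ≤ n then u * c 1 else 0) +
        (if 2 ≤ n then v * c 2 else 0) + (if 3 ≤ n then w * c 3 else 0) := by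
  simp [coinTuple, add_mul, Finset.sum_add_distrib, ite_mul, Finset.sum_ite_eq',
    Finset.mem_Icc]

lemma isRepr_coinTuple {m i : ℕ} (hm : 3 ≤ m) (hi : 1 ≤ i) (him : i ≤ m) (c : ℕ → ℕ)
    (u v w : ℕ) :
    IsRepr m c (c i + u * c 1 + v * c 2 + w * c 3) (coinTuple i u v w) := by
  unfold IsRepr
  rw [sum_coinTuple_mul, if_pos ⟨hi, him⟩, if_pos (by omega), if_pos (by omega), if_pos hm]

lemma reprSize_coinTuple {m i : ℕ} (hm : 3 ≤ m) (hi : 1 ≤ i) (him : i ≤ m) (u v w : ℕ) :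
    reprSize m (coinTuple i u v w) = 1 + u + v + w := by
  have h := sum_coinTuple_mul m i u v w (fun _ => 1)
  rw [if_pos ⟨hi, him⟩, if_pos (by omega), if_pos (by omega), if_pos hm] at h
  simpa [reprSize] using h

lemma IsCoinSystem.le {m : ℕ} {c : ℕ → ℕ} (hc : IsCoinSystem m c) {i j : ℕ} (hi : 1 ≤ i)
    (hij : i ≤ j) (hj : j ≤ m) : c i ≤ c j := by
  rcases hij.eq_or_lt with rfl | h
  · exact le_rfl
  · exact (hc.2 i j hi h hj).le

/-- If no coin lies in `(c i, c i + s]` and `s < c 3`, the greedy representation of `c i + s`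
uses `c i` once and then only the coins `c 2` and `c 1`. -/
lemma isGreedy_coinTuple {m i s : ℕ} {c : ℕ → ℕ} (hm : 3 ≤ m) (hc : IsCoinSystem m c)
    (hi : 3 ≤ i) (him : i ≤ m) (hs : s < c 3) (hgap : ∀ l, i < l → l ≤ m → c i + s < c l) :
    IsGreedy m c (c i + s) (coinTuple i (s % c 2) (s / c 2) 0) := by
  have hdiv := Nat.mod_add_div' s (c 2)
  have h2 : 0 < c 2 := by have := hc.2 1 2 (by omega) (by omega) (by omega); omega
  constructor
  · convert isRepr_coinTuple hm (by omega) him c (s % c 2) (s / c 2) 0 using 1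
    rw [hc.1]; omega
  · intro l hl hlm
    rw [sum_coinTuple_mul, hc.1]
    have hlt := Nat.mod_lt s h2
    rcases hl.eq_or_lt with rfl | hl3
    · simp
      rw [if_neg (by omega)]; omega
    · rw [if_pos (by omega : 1 ≤ l - 1), if_pos (by omega : 2 ≤ l - 1)]
      rcases lt_or_ge i l with hil | hil
      · have := hgap l hil hlm
        rw [if_pos (by omega)]; simp; omega
      · have := hc.le (by omega) (by omega : 3 ≤ l) hlm
        rw [if_neg (by omega)]; simp; omega

lemma greedy_size_le {m i s p v w : ℕ} {c : ℕ → ℕ} (hm : 3 ≤ m) (hc : IsCoinSystem m c)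
    (hno : ¬ IsCounterexample m c (c i + s))
    (hi : 3 ≤ i) (him : i ≤ m) (hs : s < c 3) (hgap : ∀ l, i < l → l ≤ m → c i + s < c l)
    (hp : 1 ≤ p) (hpm : p ≤ m) (hx : c i + s = c p + v * c 2 + w * c 3) :
    s / c 2 + s % c 2 ≤ v + w := by
  by_contra! hlt
  refine hno ⟨_, coinTuple p 0 v w, isGreedy_coinTuple hm hc hi him hs hgap, ?_, ?_⟩
  · rw [hx]
    simpa using isRepr_coinTuple hm hp hpm c 0 v w
  · rw [reprSize_coinTuple hm hp hpm, reprSize_coinTuple hm (by omega) him]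
    omega

/-- Number of coins used greedily in the system `⟨1, a⟩` is minimal. -/
lemma div_add_mod_le {a : ℕ} (ha : 0 < a) (u v : ℕ) :
    (u + v * a) / a + (u + v * a) % a ≤ u + v := by
  rw [Nat.add_mul_div_right _ _ ha, Nat.add_mul_mod_self_right]
  have h1 := Nat.mod_add_div u a
  have h2 : u / a ≤ a * (u / a) := Nat.le_mul_of_pos_left _ ha
  omega

lemma div_add_mod_step {a b k d : ℕ} (hk : 2 ≤ k) (hkd : k * a = b + d) (hd : d < a)
    (h : d = 0 ∨ d < k) (y : ℕ) :
    y / a + y % a + 1 ≤ (y + b) / a + (y + b) % a := by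
  have ha : 0 < a := by omega
  have h1 := Nat.mod_add_div' y a
  have h2 := Nat.mod_lt y ha
  obtain ⟨j, rfl⟩ := Nat.exists_eq_add_of_le' hk
  rcases le_or_gt d (y % a) with hle | hgt
  · have e : y + b = (y % a - d) + (y / a + (j + 2)) * a := by
      rw [add_mul]; omega
    rw [e, Nat.add_mul_div_right _ _ ha, Nat.add_mul_mod_self_right,
      Nat.div_eq_of_lt (by omega : y % a - d < a), Nat.mod_eq_of_lt (by omega : y % a - d < a)]
    omega
  · have e : y + b = (y % a + a - d) + (y / a + (j + 1)) * a := by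
      have : (j + 2) * a = (j + 1) * a + a := by ring
      rw [add_mul]; omega
    rw [e, Nat.add_mul_div_right _ _ ha, Nat.add_mul_mod_self_right,
      Nat.div_eq_of_lt (by omega : y % a + a - d < a),
      Nat.mod_eq_of_lt (by omega : y % a + a - d < a)]
    omega

lemma div_add_mod_steps {a b k d : ℕ} (hk : 2 ≤ k) (hkd : k * a = b + d) (hd : d < a)
    (h : d = 0 ∨ d < k) (y n : ℕ) :
    y / a + y % a + n ≤ (y + n * b) / a + (y + n * b) % a := by
  induction n with
  | zero => simp
  | succ n ih =>
    have := div_add_mod_step hk hkd hd h (y + n * b)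
    rw [show y + (n + 1) * b = y + n * b + b by ring]
    omega

lemma exists_ceil_mul {a b : ℕ} (ha : 0 < a) (hab : a < b) :
    ∃ k d, 2 ≤ k ∧ k * a = b + d ∧ d < a := by
  have h1 := Nat.mod_add_div' (b + a - 1) a
  have h2 := Nat.mod_lt (b + a - 1) ha
  refine ⟨(b + a - 1) / a, (b + a - 1) / a * a - b, ?_, by omega, by omega⟩
  rw [Nat.le_div_iff_mul_le ha]; omega

/-- The arithmetic description of non-canonical three-coin systems. -/
lemma NonCanonical.exists_multiple {c : ℕ → ℕ} (hc : IsCoinSystem 3 c) (h : NonCanonical 3 c) :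
    ∃ k d, 2 ≤ k ∧ k * c 2 = c 3 + d ∧ d < c 2 ∧ k ≤ d := by
  have h1 := hc.1
  have h12 := hc.2 1 2 (by omega) (by omega) (by omega)
  have h23 := hc.2 2 3 (by omega) (by omega) (by omega)
  obtain ⟨k, d, hk, hkd, hd⟩ := exists_ceil_mul (by omega : 0 < c 2) h23
  refine ⟨k, d, hk, hkd, hd, ?_⟩
  by_contra! hdk
  obtain ⟨x, γ, β, ⟨hγ, hg⟩, hβ, hlt⟩ := h
  have hg2 := hg 2 le_rfl (by omega)
  have hg3 := hg 3 (by omega) le_rfl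
  simp [IsRepr, reprSize, Finset.sum_Icc_succ_top, h1] at hγ hβ hlt hg2 hg3
  have hle : β 3 ≤ γ 3 := by
    by_contra! hcon
    have : (γ 3 + 1) * c 3 ≤ β 3 * c 3 := Nat.mul_le_mul_right _ hcon
    rw [add_mul] at this
    omega
  obtain ⟨n, hn⟩ := Nat.exists_eq_add_of_le hle
  have hs := div_add_mod_steps hk hkd hd (Or.inr hdk) (γ 1 + γ 2 * c 2) n
  have hb := div_add_mod_le (by omega : 0 < c 2) (β 1) (β 2)
  rw [hn, add_mul] at hγ
  rw [show γ 1 + γ 2 * c 2 + n * c 3 = β 1 + β 2 * c 2 by omega,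
    Nat.add_mul_div_right _ _ (by omega), Nat.add_mul_mod_self_right,
    Nat.div_eq_of_lt hg2, Nat.mod_eq_of_lt hg2] at hs
  omega

lemma exists_greatest_index {P : ℕ → Prop} {n N : ℕ} (hn : P n) (hnN : n ≤ N) :
    ∃ p, n ≤ p ∧ p ≤ N ∧ P p ∧ ∀ q, p < q → q ≤ N → ¬ P q := by
  classical
  exact ⟨Nat.findGreatest P N, Nat.le_findGreatest hnN hn, Nat.findGreatest_le N,
    Nat.findGreatest_spec hnN hn, fun q h1 h2 => Nat.findGreatest_is_greatest h1 h2⟩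

lemma exists_counterexample_lt {m : ℕ} (hm : 4 ≤ m) {c : ℕ → ℕ} (hc : IsCoinSystem m c)
    {k d : ℕ} (hk : 2 ≤ k) (hkd : k * c 2 = c 3 + d) (hd : d < c 2) (hle : k ≤ d) :
    ∃ x, IsCounterexample m c x ∧ x < c m + c 3 := by
  by_contra! hno
  have h1 := hc.1
  have h23 := hc.2 2 3 (by omega) (by omega) (by omega)
  have h3m := hc.le (by omega) (by omega : 3 ≤ m) le_rfl
  have key : ∀ i s p v w, 3 ≤ i → i ≤ m → s < c 3 → (∀ l, i < l → l ≤ m → c i + s < c l) →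
      1 ≤ p → p ≤ m → c i + s = c p + v * c 2 + w * c 3 → c i + s < c m + c 3 →
      s / c 2 + s % c 2 ≤ v + w := fun i s p v w hi him hs hgap hp hpm hx hlt =>
    greedy_size_le (by omega) hc (fun hce => absurd (hno _ hce) (by omega)) hi him hs hgap hp hpm hx
  have key' : ∀ i s p v w, 3 ≤ i → i ≤ m → s < c 2 → (∀ l, i < l → l ≤ m → c i + s < c l) →
      1 ≤ p → p ≤ m → c i + s = c p + v * c 2 + w * c 3 → c i + s < c m + c 3 →
      s ≤ v + w := by
    intro i s p v w hi him hs hgap hp hpm hx hlt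
    have := key i s p v w hi him (by omega) hgap hp hpm hx hlt
    rwa [Nat.div_eq_of_lt hs, Nat.mod_eq_of_lt hs, zero_add] at this
  obtain ⟨j, rfl⟩ := Nat.exists_eq_add_of_le' hk
  have hj1 : (j + 2) * c 2 = j * c 2 + 2 * c 2 := by ring
  have hj2 : (j + 1) * c 2 = j * c 2 + c 2 := by ring
  have h4 : c (3 + 1) < c 3 + c 2 := by
    by_contra! h4
    have := key' 3 d 2 (j + 1) 0 le_rfl (by omega) hd
      (fun l h h' => by have := hc.le (by omega) (by omega : 4 ≤ l) h'; simp at h4; omega)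
      (by omega) (by omega) (by omega) (by omega)
    omega
  obtain ⟨p, hp3, hpm, hp, hpmax⟩ :=
    exists_greatest_index (P := fun q => c (q + 1) < c q + c 2) h4 (by omega : 3 ≤ m - 1)
  have hpp := hc.2 p (p + 1) (by omega) (by omega) (by omega)
  have hpM := hc.le (by omega : 1 ≤ p + 1) (by omega) (le_refl m)
  have hgap : ∀ q l, p < q → q < l → l ≤ m → c q + c 2 ≤ c l := by
    intro q l hq hql hl
    have h1 : ¬ c (q + 1) < c q + c 2 := hpmax q hq (by omega)
    have h2 := hc.le (by omega) (by omega : q + 1 ≤ l) hl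
    omega
  have hstep : c (p + 1) + 1 = c p + c 2 := by
    have := key' (p + 1) (c p + c 2 - c (p + 1)) p 1 0 (by omega) (by omega) (by omega)
      (fun l h h' => by have := hgap (p + 1) l (by omega) h h'; omega)
      (by omega) (by omega) (by omega) (by omega)
    omega
  obtain ⟨r, hpr, hrm, hr, hrmax⟩ :=
    exists_greatest_index (P := fun q => c q ≤ c p + c 3) (n := p + 1) (N := m)
      (by omega) (by omega)
  have hprc := hc.le (by omega) hpr hrm
  have hrM := hc.le (by omega : 1 ≤ r) hrm (le_refl m)
  have hrgap : ∀ l, r < l → l ≤ m → c r + c 2 ≤ c l := fun l => hgap r l (by omega)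
  have hcases : c r = c p + c 3 ∨ c r + 1 = c p + c 3 ∨ c r + c 2 = c p + c 3 := by
    have hsz := key r (c p + c 3 - c r) p 0 1 (by omega) hrm (by omega)
      (fun l h h' => by have : ¬ c l ≤ c p + c 3 := hrmax l h h'; omega)
      (by omega) (by omega) (by omega) (by omega)
    have hdm := Nat.mod_add_div' (c p + c 3 - c r) (c 2)
    generalize hs : c p + c 3 - c r = s at *
    generalize s / c 2 = q, s % c 2 = t at *
    have : q = 0 ∨ q = 1 := by omega
    rcases this with rfl | rfl <;> omega
  have hjpos : j = 0 ∨ c 2 ≤ j * c 2 := by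
    rcases Nat.eq_zero_or_pos j with h | h
    · exact Or.inl h
    · exact Or.inr (Nat.le_mul_of_pos_left _ h)
  have hne : c (p + 1) < c m := by
    rcases hpr.eq_or_lt with h | h
    · rw [← h] at hcases
      rcases hjpos with rfl | h <;> omega
    · have := hc.2 (p + 1) r (by omega) h hrm
      omega
  rcases hcases with h | h | h
  · have := key' r (c 2 - 1) (p + 1) 0 1 (by omega) hrm (by omega)
      (fun l hl h' => by have := hrgap l hl h'; omega)
      (by omega) (by omega) (by omega) (by omega)
    omega
  · have := key' r d (p + 1) (j + 1) 0 (by omega) hrm (by omega)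
      (fun l hl h' => by have := hrgap l hl h'; omega)
      (by omega) (by omega) (by omega) (by omega)
    omega
  · have := key' r (d - 1) (p + 1) j 0 (by omega) hrm (by omega)
      (fun l hl h' => by have := hrgap l hl h'; omega)
      (by omega) (by omega) (by omega) (by omega)
    omega

/-- If the subsystem `⟨1, c 2, c 3⟩` is non-canonical, then for `m ≥ 4` the full
coin system `⟨1, c 2, …, c m⟩` is non-canonical and has a counterexample
`x < c m + c 3`. -/
theorem stmt_9 (m : ℕ) (hm : 4 ≤ m) (c : ℕ → ℕ) (hc : IsCoinSystem m c)
    (h : NonCanonical 3 c) :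
    NonCanonical m c ∧ ∃ x, IsCounterexample m c x ∧ x < c m + c 3 := by
  have hc3 : IsCoinSystem 3 c := ⟨hc.1, fun i j hi hij hj => hc.2 i j hi hij (by omega)⟩
  obtain ⟨k, d, hk, hkd, hd, hle⟩ := h.exists_multiple hc3
  obtain ⟨x, hx, hlt⟩ := exists_counterexample_lt hm hc hk hkd hd hle
  exact ⟨⟨x, hx⟩, x, hx, hlt⟩
end

section
/- For every integer c₃ > 3, the coin system ⟨1, 2, c₃, c₃ + 1⟩ is non-canonical; in particular, 2·c₃ is a counterexample of it. -/
/-- For every `c₃ > 3`, the coin system `⟨1, 2, c₃, c₃ + 1⟩` is non-canonical;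
in particular, `2 * c₃` is a counterexample of it. -/
theorem stmt_12 (c₃ : ℕ) (h : 3 < c₃) :
    NonCanonical 4
      (fun i => if i = 1 then 1 else if i = 2 then 2 else if i = 3 then c₃ else c₃ + 1) ∧
    IsCounterexample 4
      (fun i => if i = 1 then 1 else if i = 2 then 2 else if i = 3 then c₃ else c₃ + 1)
      (2 * c₃) := by
  suffices hc : IsCounterexample 4
      (fun i => if i = 1 then 1 else if i = 2 then 2 else if i = 3 then c₃ else c₃ + 1)
      (2 * c₃) from ⟨⟨_, hc⟩, hc⟩
  refine ⟨fun i => if i = 1 then (c₃ - 1) % 2 else if i = 2 then (c₃ - 1) / 2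
      else if i = 3 then 0 else 1, fun i => if i = 3 then 2 else 0, ⟨?_, ?_⟩, ?_, ?_⟩
  · simp [IsRepr, Finset.sum_Icc_succ_top]
    omega
  · intro i h2 h4
    interval_cases i <;> simp [Finset.sum_Icc_succ_top] <;> omega
  · simp [IsRepr, Finset.sum_Icc_succ_top]
  · simp [reprSize, Finset.sum_Icc_succ_top]
    omega
end

section
/- For every integer c₃ > 3, the coin system ⟨1, 2, c₃, c₃ + 1, 2·c₃⟩ is canonical. -/
/-- The number of coins the greedy algorithm uses for an amount `r < 2 * c` with the coins
`1, 2, c, c + 1`. -/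
def greedyRemainderSize (c r : ℕ) : ℕ :=
  if r < c then (r + 1) / 2 else 1 + (r - c) / 2

/-- The number of coins the greedy algorithm uses for `x` with the coins
`1, 2, c, c + 1, 2 * c`. -/
def greedySize (c x : ℕ) : ℕ :=
  x / (2 * c) + greedyRemainderSize c (x % (2 * c))

theorem greedySize_add_mul {c r : ℕ} (hr : r < 2 * c) (q : ℕ) :
    greedySize c (r + q * (2 * c)) = q + greedyRemainderSize c r := by
  have hc : 0 < 2 * c := by omega
  rw [greedySize, Nat.add_mul_div_right _ _ hc, Nat.add_mul_mod_self_right,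
    Nat.div_eq_of_lt hr, Nat.mod_eq_of_lt hr, Nat.zero_add]

/-- Adding one coin increases the greedy size by at most one. -/
theorem greedySize_add_coin_le {c k : ℕ} (hc : 3 < c)
    (hk : k = 1 ∨ k = 2 ∨ k = c ∨ k = c + 1 ∨ k = 2 * c) (x : ℕ) :
    greedySize c (x + k) ≤ greedySize c x + 1 := by
  obtain ⟨r, q, hr, rfl⟩ : ∃ r q, r < 2 * c ∧ x = r + q * (2 * c) :=
    ⟨x % (2 * c), x / (2 * c), Nat.mod_lt _ (by omega), (Nat.mod_add_div' x (2 * c)).symm⟩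
  rw [greedySize_add_mul hr]
  by_cases hrk : r + k < 2 * c
  · rw [show r + q * (2 * c) + k = r + k + q * (2 * c) by ring, greedySize_add_mul hrk]
    unfold greedyRemainderSize
    split_ifs <;> omega
  · rw [show r + q * (2 * c) + k = r + k - 2 * c + (q + 1) * (2 * c) by
      rw [Nat.add_mul]; omega, greedySize_add_mul (by omega)]
    unfold greedyRemainderSize
    split_ifs <;> omega

theorem greedySize_add_mul_coin_le {c k : ℕ} (hc : 3 < c)
    (hk : k = 1 ∨ k = 2 ∨ k = c ∨ k = c + 1 ∨ k = 2 * c) (x n : ℕ) :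
    greedySize c (x + n * k) ≤ greedySize c x + n := by
  induction n with
  | zero => simp
  | succ n ih =>
    have := greedySize_add_coin_le hc hk (x + n * k)
    rw [show x + (n + 1) * k = x + n * k + k by ring]
    omega

/-- Any representation has at least as many coins as the greedy size. -/
theorem greedySize_le {c : ℕ} (hc : 3 < c) (a b d e f : ℕ) :
    greedySize c (a * 1 + b * 2 + d * c + e * (c + 1) + f * (2 * c)) ≤ a + b + d + e + f := by
  have h₀ : greedySize c 0 = 0 := by simp [greedySize, greedyRemainderSize, show c ≠ 0 by omega]
  have h₁ := greedySize_add_mul_coin_le hc (k := 1) (by simp) 0 a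
  have h₂ := greedySize_add_mul_coin_le hc (k := 2) (by simp) (a * 1) b
  have h₃ := greedySize_add_mul_coin_le hc (k := c) (by simp) (a * 1 + b * 2) d
  have h₄ := greedySize_add_mul_coin_le hc (k := c + 1) (by simp) (a * 1 + b * 2 + d * c) e
  have h₅ := greedySize_add_mul_coin_le hc (k := 2 * c) (by simp)
    (a * 1 + b * 2 + d * c + e * (c + 1)) f
  rw [Nat.zero_add] at h₁
  omega

/-- The greedy size is the size of the greedy representation. -/
theorem greedySize_eq {c a b d e : ℕ} (hc : 3 < c) (f : ℕ) (ha : a * 1 < 2)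
    (hb : a * 1 + b * 2 < c) (hd : a * 1 + b * 2 + d * c < c + 1)
    (he : a * 1 + b * 2 + d * c + e * (c + 1) < 2 * c) :
    greedySize c (a * 1 + b * 2 + d * c + e * (c + 1) + f * (2 * c)) = a + b + d + e + f := by
  rw [greedySize_add_mul he]
  have hd' : d < 2 := by
    by_contra! h
    have := Nat.mul_le_mul_right c h
    omega
  have he' : e < 2 := by
    by_contra! h
    have := Nat.mul_le_mul_right (c + 1) h
    omega
  unfold greedyRemainderSize
  interval_cases d <;> interval_cases e <;> split_ifs <;> omega

/-- For every `c₃ > 3`, the coin system `⟨1, 2, c₃, c₃ + 1, 2 * c₃⟩` is canonical. -/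
theorem stmt_13 (c₃ : ℕ) (h : 3 < c₃) :
    IsCanonical 5
      (fun i => if i = 1 then 1 else if i = 2 then 2 else if i = 3 then c₃
        else if i = 4 then c₃ + 1 else 2 * c₃) := by
  rintro x ⟨γ, β, ⟨hγ, hg⟩, hβ, hlt⟩
  have h₂ := hg 2 (by norm_num) (by norm_num)
  have h₃ := hg 3 (by norm_num) (by norm_num)
  have h₄ := hg 4 (by norm_num) (by norm_num)
  have h₅ := hg 5 (by norm_num) (by norm_num)
  norm_num [IsRepr, reprSize, Finset.sum_Icc_succ_top] at hγ hβ hlt h₂ h₃ h₄ h₅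
  have hle := greedySize_le h (β 1) (β 2) (β 3) (β 4) (β 5)
  have heq := greedySize_eq h (γ 5) (a := γ 1) (b := γ 2) (d := γ 3) (e := γ 4)
    (by omega) (by omega) (by omega) (by omega)
  rw [show β 1 * 1 + β 2 * 2 + β 3 * c₃ + β 4 * (c₃ + 1) + β 5 * (2 * c₃) = x by omega] at hle
  rw [show γ 1 * 1 + γ 2 * 2 + γ 3 * c₃ + γ 4 * (c₃ + 1) + γ 5 * (2 * c₃) = x by omega] at heq
  omega
end

section
/- Let ⟨1, c₂, c₃, c₂ + c₃ − 1⟩ and ⟨1, c₂, c₃, c₂ + c₃ − 1, c₂ + 2·c₃ − 2⟩ be coin systems such that ⟨1, c₂, c₃, c₂ + c₃ − 1, c₂ + 2·c₃ − 2⟩ is canonical but ⟨1, c₂, c₃, c₂ + c₃ − 1⟩ is not. Then the coin system ⟨1, c₂, c₃⟩ is canonical. -/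
theorem sum_Icc_one_five (f : ℕ → ℕ) :
    ∑ i ∈ Finset.Icc 1 5, f i = f 1 + f 2 + f 3 + f 4 + f 5 := by
  simp [Finset.sum_Icc_succ_top]

theorem sum_Icc_one_four (f : ℕ → ℕ) :
    ∑ i ∈ Finset.Icc 1 4, f i = f 1 + f 2 + f 3 + f 4 := by
  simp [Finset.sum_Icc_succ_top]

theorem sum_Icc_one_three (f : ℕ → ℕ) :
    ∑ i ∈ Finset.Icc 1 3, f i = f 1 + f 2 + f 3 := by
  simp [Finset.sum_Icc_succ_top]

theorem sum_Icc_one_two (f : ℕ → ℕ) :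
    ∑ i ∈ Finset.Icc 1 2, f i = f 1 + f 2 := by
  simp [Finset.sum_Icc_succ_top]

/-- The function with values `v₁, …, v₅` at `1, …, 5` and `0` elsewhere. -/
def coeffs (v₁ v₂ v₃ v₄ v₅ : ℕ) : ℕ → ℕ
  | 1 => v₁
  | 2 => v₂
  | 3 => v₃
  | 4 => v₄
  | 5 => v₅
  | _ => 0

/-- In a canonical system of five coins, a greedy coefficient vector is no larger than any
other coefficient vector of the same value. -/
theorem IsCanonical.size_le {c : ℕ → ℕ} (hcan : IsCanonical 5 c) (h1 : c 1 = 1)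
    {g₁ g₂ g₃ g₄ g₅ x₁ x₂ x₃ x₄ x₅ : ℕ}
    (hg₂ : g₁ < c 2) (hg₃ : g₁ + g₂ * c 2 < c 3) (hg₄ : g₁ + g₂ * c 2 + g₃ * c 3 < c 4)
    (hg₅ : g₁ + g₂ * c 2 + g₃ * c 3 + g₄ * c 4 < c 5)
    (h : x₁ + x₂ * c 2 + x₃ * c 3 + x₄ * c 4 + x₅ * c 5 =
      g₁ + g₂ * c 2 + g₃ * c 3 + g₄ * c 4 + g₅ * c 5) :
    g₁ + g₂ + g₃ + g₄ + g₅ ≤ x₁ + x₂ + x₃ + x₄ + x₅ := by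
  by_contra! hlt
  refine hcan (g₁ + g₂ * c 2 + g₃ * c 3 + g₄ * c 4 + g₅ * c 5)
    ⟨coeffs g₁ g₂ g₃ g₄ g₅, coeffs x₁ x₂ x₃ x₄ x₅, ⟨?_, fun i hi hi' => ?_⟩, ?_, ?_⟩
  · simp [IsRepr, sum_Icc_one_five, coeffs, h1]
  · interval_cases i <;>
      simpa [sum_Icc_one_two, sum_Icc_one_three, sum_Icc_one_four, coeffs, h1]
  · simpa [IsRepr, sum_Icc_one_five, coeffs, h1] using h
  · simpa [reprSize, sum_Icc_one_five, coeffs] using hlt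

/-- Sufficiency of the one-point test for three coins `1 < a < b` with `b + δ = (k + 1) * a`:
greedy vectors have minimum size once `(k + 1) * a` is paid greedily with at most `k + 1` coins. -/
theorem greedy_three_size_le {a b k δ g₁ g₂ g₃ : ℕ} (ha : 1 < a) (hb : b + δ = (k + 1) * a)
    (hδa : δ < a) (hδ : δ ≤ k) (hg₂ : g₁ < a) (hg₃ : g₁ + g₂ * a < b) (x y z : ℕ)
    (h : x + y * a + z * b = g₁ + g₂ * a + g₃ * b) :
    g₁ + g₂ + g₃ ≤ x + y + z := by
  induction hn : 2 * x + 3 * y using Nat.strong_induction_on generalizing x y z with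
  | _ n ih =>
    subst hn
    by_cases hx : a ≤ x
    · obtain ⟨x, rfl⟩ := Nat.exists_eq_add_of_le hx
      have := ih _ (by omega) x (y + 1) z (by linarith) rfl
      omega
    by_cases hy : k + 1 ≤ y
    · obtain ⟨y, rfl⟩ := Nat.exists_eq_add_of_le hy
      have := ih _ (by omega) (x + δ) y (z + 1) (by linarith) rfl
      omega
    by_cases hxy : b ≤ x + y * a
    · obtain rfl : y = k := by
        by_contra hne
        have : (y + 1) * a ≤ k * a := Nat.mul_le_mul_right _ (by omega)
        linarith
      obtain ⟨w, hw⟩ : ∃ w, x + δ = a + w := Nat.exists_eq_add_of_le (by linarith)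
      obtain ⟨e, rfl⟩ := Nat.exists_eq_add_of_lt hδa
      obtain rfl : x = e + 1 + w := by omega
      have := ih _ (by omega) w 0 (z + 1) (by linarith) rfl
      omega
    have hz : z = g₃ := by
      have h' := congrArg (· / b) h
      simpa [Nat.add_mul_div_right _ _ (show 0 < b by omega),
        Nat.div_eq_of_lt (not_le.1 hxy), Nat.div_eq_of_lt hg₃] using h'
    subst hz
    have hy' : y = g₂ := by
      have h' := congrArg (· / a) (Nat.add_right_cancel h)
      simpa [Nat.add_mul_div_right _ _ (show 0 < a by omega),
        Nat.div_eq_of_lt (not_le.1 hx), Nat.div_eq_of_lt hg₂] using h'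
    subst hy'
    omega

/-- If `⟨1, c 2, c 3, c 2 + c 3 - 1, c 2 + 2 * c 3 - 2⟩` is canonical but
`⟨1, c 2, c 3, c 2 + c 3 - 1⟩` is not, then `⟨1, c 2, c 3⟩` is canonical. -/
theorem stmt_14 (c : ℕ → ℕ) (hc : IsCoinSystem 5 c)
    (h4 : c 4 = c 2 + c 3 - 1) (h5 : c 5 = c 2 + 2 * c 3 - 2)
    (hcan : IsCanonical 5 c) (hnon : NonCanonical 4 c) :
    IsCanonical 3 c := by
  obtain ⟨h1, hlt⟩ := hc
  have ha : 1 < c 2 := h1 ▸ hlt 1 2 (by norm_num) (by norm_num) (by norm_num)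
  have hab : c 2 < c 3 := hlt 2 3 (by norm_num) (by norm_num) (by norm_num)
  obtain ⟨k, δ, hb, hδa⟩ : ∃ k δ, c 3 + δ = (k + 1) * c 2 ∧ δ < c 2 := by
    refine ⟨(c 3 - 1) / c 2, c 2 - 1 - (c 3 - 1) % c 2, ?_, by omega⟩
    have h := Nat.div_add_mod' (c 3 - 1) (c 2)
    have := Nat.mod_lt (c 3 - 1) (show 0 < c 2 by omega)
    rw [add_mul]
    omega
  have hδ : δ ≤ k := by
    by_contra! hk
    by_cases hδ' : δ < c 2 - 1
    · have := hcan.size_le h1 (g₁ := δ) (g₂ := 0) (g₃ := 1) (g₄ := 0) (g₅ := 0)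
        (x₁ := 0) (x₂ := k + 1) (x₃ := 0) (x₄ := 0) (x₅ := 0) hδa
        (by omega) (by omega) (by omega) (by linarith)
      omega
    · rcases k with _ | k
      · omega
      have hb' : c 3 = k * c 2 + c 2 + 1 := by
        have : (k + 1 + 1) * c 2 = k * c 2 + c 2 + c 2 := by ring
        omega
      have := hcan.size_le h1 (g₁ := 2) (g₂ := k) (g₃ := 0) (g₄ := 1) (g₅ := 0)
        (x₁ := 0) (x₂ := 0) (x₃ := 2) (x₄ := 0) (x₅ := 0)
        (by omega) (by omega) (by omega) (by omega) (by omega)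
      omega
  rintro x ⟨γ, β, ⟨hγ, hγ'⟩, hβ, hsize⟩
  have hg₂ := hγ' 2 le_rfl (by norm_num)
  have hg₃ := hγ' 3 (by norm_num) le_rfl
  simp only [IsRepr, reprSize, sum_Icc_one_three, h1, mul_one] at hγ hβ hsize
  simp [h1] at hg₂
  simp [sum_Icc_one_two, h1] at hg₃
  exact hsize.not_ge (greedy_three_size_le ha hb hδa hδ hg₂ hg₃ _ _ _ (hβ.trans hγ.symm))
end
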